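/- For the spectral sequence of the filtered complex (C, F): E_1^{i,j} = 0 whenever j is odd; E_1^{i,0} ≅ Ω^i, with d_1 : E_1^{i,0} → E_1^{i+1,0} given by α ↦ dα; and for each j > 0, E_1^{i,2j} ≅ (Ω^i/G^i) ⊗ ℝ·u^j, with d_1 : E_1^{i,2j} → E_1^{i+1,2j} induced by d (i.e., the differential of the co-Gysin complex 𝒦 = Ω/G). -/

import Mathlib

/-!
Common algebraic model for the paper "Intersection cohomology of circle actions"
(Padilla–Saralegi), following the CONTEXT of the statements.

`A` models the (total space of the) graded-commutative differential graded ℝ-algebra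
`A = ⊕ₙ Aⁿ` of liftable forms on the orbit space `B`; the grading is only recorded
through the families of graded subspaces `P Q : ℤ → Submodule ℝ A` (the forms of
perverse degree `≤ p̄` resp. `≤ p̄ - x̄`), which vanish in negative degrees
(`Aⁿ = 0` for `n < 0`).  The differential is `d` with `d ∘ d = 0`, and
`e : A →ₗ[ℝ] A` is right multiplication by the fixed Euler form `ε ∈ A²`;
the hypotheses `dε = 0` together with the graded Leibniz rule amount exactly to
the commutation `d ∘ e = e ∘ d`, which is how we encode them.
-/

open Submodule LinearMap

noncomputable section

namespace IG

variable {A : Type*} [AddCommGroup A] [Module ℝ A]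

/-- `Ω^n = {α ∈ P^n : dα ∈ P^(n+1)}`. -/
def Om (d : A →ₗ[ℝ] A) (P : ℤ → Submodule ℝ A) (n : ℤ) : Submodule ℝ A :=
  P n ⊓ (P (n + 1)).comap d

/-- First component of `D` in degree `n` : `(α, β) ↦ dα + (-1)^(n-1) β∧ε`. -/
def D1 (d e : A →ₗ[ℝ] A) (n : ℤ) : A × A →ₗ[ℝ] A :=
  d ∘ₗ LinearMap.fst ℝ A A + ((-1 : ℝ) ^ (n - 1)) • (e ∘ₗ LinearMap.snd ℝ A A)

/-- `D(α,β) = (dα + (-1)^(n-1) β∧ε, dβ)` in degree `n`. -/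
def Dmap (d e : A →ₗ[ℝ] A) (n : ℤ) : A × A →ₗ[ℝ] A × A :=
  (D1 d e n).prod (d ∘ₗ LinearMap.snd ℝ A A)

/-- `K^n = {(α,β) ∈ P^n × Q^(n-1) : dβ ∈ Q^n, dα + (-1)^(n-1) β∧ε ∈ P^(n+1)}`. -/
def Ksub (d e : A →ₗ[ℝ] A) (P Q : ℤ → Submodule ℝ A) (n : ℤ) : Submodule ℝ (A × A) :=
  (P n).comap (LinearMap.fst ℝ A A) ⊓ (Q (n - 1)).comap (LinearMap.snd ℝ A A) ⊓
    (Q n).comap (d ∘ₗ LinearMap.snd ℝ A A) ⊓ (P (n + 1)).comap (D1 d e n)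

/-- `G^n = {β ∈ Q^n : dβ ∈ Q^(n+1), ∃ α ∈ P^(n+1), dα + (-1)^n β∧ε ∈ P^(n+2)}`. -/
def Gsub (d e : A →ₗ[ℝ] A) (P Q : ℤ → Submodule ℝ A) (n : ℤ) : Submodule ℝ A :=
  Q n ⊓ (Q (n + 1)).comap d ⊓
    (((P (n + 1)).comap (LinearMap.fst ℝ A A) ⊓
        (P (n + 2)).comap
          (d ∘ₗ LinearMap.fst ℝ A A + ((-1 : ℝ) ^ n) • (e ∘ₗ LinearMap.snd ℝ A A))).map
      (LinearMap.snd ℝ A A))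

/-- `C^m = ⊕_{i+2j=m} K^i ⊗ ℝ·u^j`, realized as the functions `ω : ℕ → A × A`
(`ω j` = the coefficient of `u^j`) with `ω j ∈ K^(m-2j)` for all `j`. -/
def Csub (d e : A →ₗ[ℝ] A) (P Q : ℤ → Submodule ℝ A) (m : ℤ) : Submodule ℝ (ℕ → A × A) :=
  ⨅ j : ℕ, (Ksub d e P Q (m - 2 * (j : ℤ))).comap (LinearMap.proj (R := ℝ) j)

/-- `∇((α,β) ⊗ u^j) = D(α,β) ⊗ u^j + (-1)^(n-1) (β,0) ⊗ u^(j+1)` on total degree `m`. -/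
def nabla (d e : A →ₗ[ℝ] A) (m : ℤ) : (ℕ → A × A) →ₗ[ℝ] (ℕ → A × A) :=
  LinearMap.pi fun j : ℕ =>
    Dmap d e (m - 2 * (j : ℤ)) ∘ₗ LinearMap.proj j +
      if j = 0 then 0
      else ((-1 : ℝ) ^ (m - 2 * ((j : ℤ) - 1) - 1)) •
        (LinearMap.inl ℝ A A ∘ₗ LinearMap.snd ℝ A A ∘ₗ LinearMap.proj (j - 1))

/-- Multiplication by `u` (degree 2) on an `ℝ[u]`-module realized as `ℕ → M`. -/
def shiftL (M : Type*) [AddCommGroup M] [Module ℝ M] : (ℕ → M) →ₗ[ℝ] (ℕ → M) :=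
  LinearMap.pi fun j : ℕ => if j = 0 then 0 else LinearMap.proj (j - 1)

/-- `π' (α ⊗ u^j) = (α, 0) ⊗ u^j`. -/
def piMap : (ℕ → A) →ₗ[ℝ] ℕ → A × A :=
  LinearMap.pi fun j : ℕ => LinearMap.inl ℝ A A ∘ₗ LinearMap.proj j

/-- `∮' ((α,β) ⊗ u^j) = β ⊗ u^j`. -/
def ointMap : (ℕ → A × A) →ₗ[ℝ] ℕ → A :=
  LinearMap.pi fun j : ℕ => LinearMap.snd ℝ A A ∘ₗ LinearMap.proj j

/-- `d ⊗ 1`. -/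
def dpi (d : A →ₗ[ℝ] A) : (ℕ → A) →ₗ[ℝ] ℕ → A :=
  LinearMap.pi fun j : ℕ => d ∘ₗ LinearMap.proj j

/-- `(Ω ⊗ ℝ[u])^m`. -/
def OmC (d : A →ₗ[ℝ] A) (P : ℤ → Submodule ℝ A) (m : ℤ) : Submodule ℝ (ℕ → A) :=
  ⨅ j : ℕ, (Om d P (m - 2 * (j : ℤ))).comap (LinearMap.proj (R := ℝ) j)

/-- `(G[-1] ⊗ ℝ[u])^m` (`G[-1]` places `G^n` in degree `n+1`). -/
def GCs (d e : A →ₗ[ℝ] A) (P Q : ℤ → Submodule ℝ A) (m : ℤ) : Submodule ℝ (ℕ → A) :=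
  ⨅ j : ℕ, (Gsub d e P Q (m - 1 - 2 * (j : ℤ))).comap (LinearMap.proj (R := ℝ) j)

/-- Cohomology presented as (cocycles) / (coboundaries). -/
abbrev Hq {M : Type*} [AddCommGroup M] [Module ℝ M] (Z B : Submodule ℝ M) :=
  Z ⧸ (B.comap Z.subtype)

/-- Cocycles of `Ω`. -/
def ZOm (d : A →ₗ[ℝ] A) (P : ℤ → Submodule ℝ A) (n : ℤ) : Submodule ℝ A :=
  Om d P n ⊓ LinearMap.ker d

/-- Coboundaries of `Ω`. -/
def BOm (d : A →ₗ[ℝ] A) (P : ℤ → Submodule ℝ A) (n : ℤ) : Submodule ℝ A :=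
  (Om d P (n - 1)).map d

/-- `H^n(Ω)`. -/
abbrev HOm (d : A →ₗ[ℝ] A) (P : ℤ → Submodule ℝ A) (n : ℤ) :=
  Hq (ZOm d P n) (BOm d P n)

/-- Cocycles of `G`. -/
def ZG (d e : A →ₗ[ℝ] A) (P Q : ℤ → Submodule ℝ A) (n : ℤ) : Submodule ℝ A :=
  Gsub d e P Q n ⊓ LinearMap.ker d

/-- Coboundaries of `G`. -/
def BG (d e : A →ₗ[ℝ] A) (P Q : ℤ → Submodule ℝ A) (n : ℤ) : Submodule ℝ A :=
  (Gsub d e P Q (n - 1)).map d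

/-- `H^n(G)`. -/
abbrev HG (d e : A →ₗ[ℝ] A) (P Q : ℤ → Submodule ℝ A) (n : ℤ) :=
  Hq (ZG d e P Q n) (BG d e P Q n)

/-- The co-Gysin space `𝒦^n = Ω^n / G^n` (cochain level). -/
abbrev Kq (d e : A →ₗ[ℝ] A) (P Q : ℤ → Submodule ℝ A) (n : ℤ) :=
  (Om d P n) ⧸ ((Gsub d e P Q n).comap (Om d P n).subtype)

/-- Cocycles of the co-Gysin complex `𝒦 = Ω/G`, presented by representatives:
`α ∈ Ω^n` with `dα ∈ G^(n+1)`. -/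
def ZKo (d e : A →ₗ[ℝ] A) (P Q : ℤ → Submodule ℝ A) (n : ℤ) : Submodule ℝ A :=
  Om d P n ⊓ (Gsub d e P Q (n + 1)).comap d

/-- Representatives of coboundaries of `𝒦 = Ω/G`. -/
def BKo (d e : A →ₗ[ℝ] A) (P Q : ℤ → Submodule ℝ A) (n : ℤ) : Submodule ℝ A :=
  Gsub d e P Q n ⊔ (Om d P (n - 1)).map d

/-- `H^n(𝒦)`. -/
abbrev HKo (d e : A →ₗ[ℝ] A) (P Q : ℤ → Submodule ℝ A) (n : ℤ) :=
  Hq (ZKo d e P Q n) (BKo d e P Q n)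

/-- Cocycles of `(C, ∇)`. -/
def ZC (d e : A →ₗ[ℝ] A) (P Q : ℤ → Submodule ℝ A) (m : ℤ) : Submodule ℝ (ℕ → A × A) :=
  Csub d e P Q m ⊓ LinearMap.ker (nabla d e m)

/-- Coboundaries of `(C, ∇)`. -/
def BC (d e : A →ₗ[ℝ] A) (P Q : ℤ → Submodule ℝ A) (m : ℤ) : Submodule ℝ (ℕ → A × A) :=
  (Csub d e P Q (m - 1)).map (nabla d e (m - 1))

/-- `H^m(C)`, the equivariant intersection cohomology. -/
abbrev HC (d e : A →ₗ[ℝ] A) (P Q : ℤ → Submodule ℝ A) (m : ℤ) :=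
  Hq (ZC d e P Q m) (BC d e P Q m)

/-- Cocycles of `(Ω ⊗ ℝ[u], d ⊗ 1)`. -/
def ZOmC (d : A →ₗ[ℝ] A) (P : ℤ → Submodule ℝ A) (m : ℤ) : Submodule ℝ (ℕ → A) :=
  OmC d P m ⊓ LinearMap.ker (dpi d)

/-- Coboundaries of `(Ω ⊗ ℝ[u], d ⊗ 1)`. -/
def BOmC (d : A →ₗ[ℝ] A) (P : ℤ → Submodule ℝ A) (m : ℤ) : Submodule ℝ (ℕ → A) :=
  (OmC d P (m - 1)).map (dpi d)

/-- `[H(Ω) ⊗ ℝ[u]]^m`, as the cohomology of the complex `(Ω ⊗ ℝ[u], d ⊗ 1)`. -/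
abbrev HOmCq (d : A →ₗ[ℝ] A) (P : ℤ → Submodule ℝ A) (m : ℤ) :=
  Hq (ZOmC d P m) (BOmC d P m)

/-- Cocycles of `(G[-1] ⊗ ℝ[u], d ⊗ 1)`. -/
def ZGC (d e : A →ₗ[ℝ] A) (P Q : ℤ → Submodule ℝ A) (m : ℤ) : Submodule ℝ (ℕ → A) :=
  GCs d e P Q m ⊓ LinearMap.ker (dpi d)

/-- Coboundaries of `(G[-1] ⊗ ℝ[u], d ⊗ 1)`. -/
def BGC (d e : A →ₗ[ℝ] A) (P Q : ℤ → Submodule ℝ A) (m : ℤ) : Submodule ℝ (ℕ → A) :=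
  (GCs d e P Q (m - 1)).map (dpi d)

/-- `[H(G) ⊗ ℝ[u]]^(m-1)`, as the cohomology of `(G[-1] ⊗ ℝ[u], d ⊗ 1)` in degree `m`. -/
abbrev HGCq (d e : A →ₗ[ℝ] A) (P Q : ℤ → Submodule ℝ A) (m : ℤ) :=
  Hq (ZGC d e P Q m) (BGC d e P Q m)

/-- The subspace of `ω : ℕ → A × A` supported in (filtration) degrees `≥ i`
(for total degree `m`): `ω j = 0` whenever `m - 2j < i`. -/
def Supp (i m : ℤ) : Submodule ℝ (ℕ → A × A) :=
  ⨅ (j : ℕ) (_ : m - 2 * (j : ℤ) < i),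
    LinearMap.ker (LinearMap.proj (R := ℝ) (φ := fun _ : ℕ => A × A) j)

/-- The filtration `F^i C^m = {ω ∈ ⊕_{i'≥i} K^{i'} ⊗ ℝ[u] of total degree m :
∇ω ∈ ⊕_{i'≥i} K^{i'} ⊗ ℝ[u]}`. -/
def FC (d e : A →ₗ[ℝ] A) (P Q : ℤ → Submodule ℝ A) (i m : ℤ) : Submodule ℝ (ℕ → A × A) :=
  Csub d e P Q m ⊓ Supp i m ⊓ (Supp i (m + 1)).comap (nabla d e m)

/-- `Z_r^{i,j} = F^i C^(i+j) ∩ ∇⁻¹(F^(i+r) C^(i+j+1))`. -/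
def Zsp (d e : A →ₗ[ℝ] A) (P Q : ℤ → Submodule ℝ A) (r i j : ℤ) : Submodule ℝ (ℕ → A × A) :=
  FC d e P Q i (i + j) ⊓ (FC d e P Q (i + r) (i + j + 1)).comap (nabla d e (i + j))

/-- `B_r^{i,j} = F^i C^(i+j) ∩ ∇(F^(i-r) C^(i+j-1))`. -/
def Bsp (d e : A →ₗ[ℝ] A) (P Q : ℤ → Submodule ℝ A) (r i j : ℤ) : Submodule ℝ (ℕ → A × A) :=
  FC d e P Q i (i + j) ⊓ (FC d e P Q (i - r) (i + j - 1)).map (nabla d e (i + j - 1))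

/-- `E_r^{i,j} = Z_r^{i,j} / (Z_(r-1)^{i+1,j-1} + B_(r-1)^{i,j})`. -/
abbrev Esp (d e : A →ₗ[ℝ] A) (P Q : ℤ → Submodule ℝ A) (r i j : ℤ) :=
  Zsp d e P Q r i j ⧸
    ((Zsp d e P Q (r - 1) (i + 1) (j - 1) ⊔ Bsp d e P Q (r - 1) i j).comap
      (Zsp d e P Q r i j).subtype)

/-- The differential `d_r : E_r^{i,j} → E_r^{i+r,j-r+1}` is the map induced by `∇`
(the target indices `(i', j')` are given freely, to be instantiated by
expressions equal to `(i + r, j - r + 1)`). -/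
def DrChar (d e : A →ₗ[ℝ] A) (P Q : ℤ → Submodule ℝ A) (r i j i' j' : ℤ)
    (dr : Esp d e P Q r i j →ₗ[ℝ] Esp d e P Q r i' j') : Prop :=
  ∀ (ω : ℕ → A × A) (hω : ω ∈ Zsp d e P Q r i j)
    (hω' : nabla d e (i + j) ω ∈ Zsp d e P Q r i' j'),
    dr (Submodule.Quotient.mk ⟨ω, hω⟩) = Submodule.Quotient.mk ⟨nabla d e (i + j) ω, hω'⟩

/-- `α ↦ (α, 0) ⊗ u^0 = (α,0) ⊗ 1`. -/
def embL : A →ₗ[ℝ] ℕ → A × A :=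
  LinearMap.single ℝ (fun _ : ℕ => A × A) 0 ∘ₗ LinearMap.inl ℝ A A

/-- `ι̃ : H^n(G) → H^{n'}(Ω)` induced by the inclusion `G ⊆ Ω` (`n' = n`). -/
def iotaChar (d e : A →ₗ[ℝ] A) (P Q : ℤ → Submodule ℝ A) (n n' : ℤ)
    (ι : HG d e P Q n →ₗ[ℝ] HOm d P n') : Prop :=
  ∀ (β : A) (hβ : β ∈ ZG d e P Q n) (hβ' : β ∈ ZOm d P n'),
    ι (Submodule.Quotient.mk ⟨β, hβ⟩) = Submodule.Quotient.mk ⟨β, hβ'⟩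

/-- `𝕖 : H^n(G) → H^{n'}(Ω)`, `𝕖[β] = [dα + (-1)^n β∧ε]` for any witness `α`
(`n' = n + 2`). -/
def eulerChar (d e : A →ₗ[ℝ] A) (P Q : ℤ → Submodule ℝ A) (n n' : ℤ)
    (E : HG d e P Q n →ₗ[ℝ] HOm d P n') : Prop :=
  ∀ (β : A) (hβ : β ∈ ZG d e P Q n) (α : A) (_ : α ∈ P (n + 1))
    (hz : d α + ((-1 : ℝ) ^ n) • e β ∈ ZOm d P n'),
    E (Submodule.Quotient.mk ⟨β, hβ⟩) =
      Submodule.Quotient.mk ⟨d α + ((-1 : ℝ) ^ n) • e β, hz⟩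

/-- `∂ : H^n(𝒦) → H^{n'}(G)`, `∂[ᾱ] = [dα]` (`n' = n + 1`). -/
def partialChar (d e : A →ₗ[ℝ] A) (P Q : ℤ → Submodule ℝ A) (n n' : ℤ)
    (pd : HKo d e P Q n →ₗ[ℝ] HG d e P Q n') : Prop :=
  ∀ (α : A) (hα : α ∈ ZKo d e P Q n) (hd : d α ∈ ZG d e P Q n'),
    pd (Submodule.Quotient.mk ⟨α, hα⟩) = Submodule.Quotient.mk ⟨d α, hd⟩

/-- `Pr : H^n(Ω) → H^{n'}(𝒦)` induced by the projection `Ω → 𝒦 = Ω/G` (`n' = n`). -/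
def prChar (d e : A →ₗ[ℝ] A) (P Q : ℤ → Submodule ℝ A) (n n' : ℤ)
    (pr : HOm d P n →ₗ[ℝ] HKo d e P Q n') : Prop :=
  ∀ (α : A) (hα : α ∈ ZOm d P n) (hα' : α ∈ ZKo d e P Q n'),
    pr (Submodule.Quotient.mk ⟨α, hα⟩) = Submodule.Quotient.mk ⟨α, hα'⟩

section FirstPage

variable {d e : A →ₗ[ℝ] A} {P Q : ℤ → Submodule ℝ A}

lemma mem_Om {n : ℤ} {α : A} : α ∈ Om d P n ↔ α ∈ P n ∧ d α ∈ P (n + 1) := Iff.rfl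

lemma mem_Gsub {n : ℤ} {β : A} :
    β ∈ Gsub d e P Q n ↔ β ∈ Q n ∧ d β ∈ Q (n + 1) ∧
      ∃ α ∈ P (n + 1), d α + ((-1 : ℝ) ^ n) • e β ∈ P (n + 2) := by
  simp only [Gsub, Submodule.mem_inf, Submodule.mem_comap, Submodule.mem_map, Prod.exists,
    LinearMap.add_apply, LinearMap.comp_apply, LinearMap.fst_apply, LinearMap.snd_apply,
    LinearMap.smul_apply, and_assoc]
  simp only [exists_eq_right_right]

lemma mem_Ksub {n : ℤ} {x : A × A} :
    x ∈ Ksub d e P Q n ↔ x.1 ∈ P n ∧ x.2 ∈ Q (n - 1) ∧ d x.2 ∈ Q n ∧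
      d x.1 + ((-1 : ℝ) ^ (n - 1)) • e x.2 ∈ P (n + 1) := by
  simp [Ksub, D1, and_assoc]

lemma mem_Csub {m : ℤ} {ω : ℕ → A × A} :
    ω ∈ Csub d e P Q m ↔ ∀ j : ℕ, ω j ∈ Ksub d e P Q (m - 2 * (j : ℤ)) := by
  simp [Csub]

lemma mem_Supp {i m : ℤ} {ω : ℕ → A × A} :
    ω ∈ (Supp i m : Submodule ℝ (ℕ → A × A)) ↔ ∀ j : ℕ, m - 2 * (j : ℤ) < i → ω j = 0 := by
  simp [Supp]

lemma mem_FC {i m : ℤ} {ω : ℕ → A × A} :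
    ω ∈ FC d e P Q i m ↔
      ω ∈ Csub d e P Q m ∧ ω ∈ (Supp i m : Submodule ℝ (ℕ → A × A)) ∧
        nabla d e m ω ∈ (Supp i (m + 1) : Submodule ℝ (ℕ → A × A)) := by
  simp [FC, and_assoc]

lemma mem_Zsp {r i j : ℤ} {ω : ℕ → A × A} :
    ω ∈ Zsp d e P Q r i j ↔
      ω ∈ FC d e P Q i (i + j) ∧ nabla d e (i + j) ω ∈ FC d e P Q (i + r) (i + j + 1) :=
  Iff.rfl

lemma nabla_zero_fst (m : ℤ) (ω : ℕ → A × A) :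
    (nabla d e m ω 0).1 = d (ω 0).1 + ((-1 : ℝ) ^ (m - 1)) • e (ω 0).2 := by
  simp [nabla, Dmap, D1]

lemma nabla_succ_fst (m : ℤ) (ω : ℕ → A × A) (j : ℕ) :
    (nabla d e m ω (j + 1)).1 =
      d (ω (j + 1)).1 + ((-1 : ℝ) ^ (m - 2 * ((j + 1 : ℕ) : ℤ) - 1)) • e (ω (j + 1)).2 +
        ((-1 : ℝ) ^ (m - 2 * (j : ℤ) - 1)) • (ω j).2 := by
  simp [nabla, Dmap, D1]

lemma nabla_snd (m : ℤ) (ω : ℕ → A × A) (j : ℕ) : (nabla d e m ω j).2 = d (ω j).2 := by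
  cases j <;> simp [nabla, Dmap, D1]

lemma neg_one_zpow_add_one (n : ℤ) : (-1 : ℝ) ^ (n + 1) = -(-1 : ℝ) ^ n := by
  rw [zpow_add_one₀ (by norm_num)]; ring

/-- `∇ ∘ ∇ = 0`. -/
lemma nabla_nabla (hd : d ∘ₗ d = 0) (hde : d ∘ₗ e = e ∘ₗ d) {m m' : ℤ} (hm : m' = m + 1)
    (ω : ℕ → A × A) : nabla d e m' (nabla d e m ω) = 0 := by
  subst hm
  have hdd : ∀ x, d (d x) = 0 := fun x => LinearMap.congr_fun hd x
  have hed : ∀ x, d (e x) = e (d x) := fun x => LinearMap.congr_fun hde x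
  funext j
  refine Prod.ext ?_ (by simp [nabla_snd, hdd])
  cases j with
  | zero =>
    rw [nabla_zero_fst, nabla_zero_fst, nabla_snd,
      show m + 1 - 1 = (m - 1) + 1 by ring, neg_one_zpow_add_one]
    simp [hdd, hed]
  | succ j =>
    rw [nabla_succ_fst, nabla_succ_fst, nabla_snd, nabla_snd,
      show m + 1 - 2 * ((j + 1 : ℕ) : ℤ) - 1 = (m - 2 * ((j + 1 : ℕ) : ℤ) - 1) + 1 by ring,
      show m + 1 - 2 * (j : ℤ) - 1 = (m - 2 * (j : ℤ) - 1) + 1 by ring,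
      neg_one_zpow_add_one, neg_one_zpow_add_one]
    simp only [map_add, map_smul, hdd, hed, neg_smul, Pi.zero_apply, Prod.fst_zero]
    abel

/-- `∇` maps `C^m` into `C^(m+1)`. -/
lemma nabla_mem_Csub (hd : d ∘ₗ d = 0) (hde : d ∘ₗ e = e ∘ₗ d) (hQP : ∀ n, Q n ≤ P n)
    {m m' : ℤ} (hm : m' = m + 1) {ω : ℕ → A × A} (hω : ω ∈ Csub d e P Q m) :
    nabla d e m ω ∈ Csub d e P Q m' := by
  subst hm
  have hdd : ∀ x, d (d x) = 0 := fun x => LinearMap.congr_fun hd x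
  have hed : ∀ x, d (e x) = e (d x) := fun x => LinearMap.congr_fun hde x
  rw [mem_Csub] at hω ⊢
  intro j
  obtain ⟨h1, h2, h3, h4⟩ := mem_Ksub.1 (hω j)
  rw [mem_Ksub, nabla_snd, hdd]
  have hQ : d (ω j).2 ∈ Q (m + 1 - 2 * (j : ℤ) - 1) := by
    convert h3 using 2; ring
  cases j with
  | zero =>
    rw [nabla_zero_fst]
    simp only [Nat.cast_zero, mul_zero, sub_zero] at *
    refine ⟨h4, hQ, zero_mem _, ?_⟩
    rw [show m + 1 - 1 = (m - 1) + 1 by ring, neg_one_zpow_add_one]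
    simp [hdd, hed]
  | succ j =>
    obtain ⟨-, k2, k3, -⟩ := mem_Ksub.1 (hω j)
    rw [nabla_succ_fst]
    refine ⟨add_mem ?_ (Submodule.smul_mem _ _ ?_), hQ, zero_mem _, ?_⟩
    · convert h4 using 2; ring
    · refine hQP _ ?_
      convert k2 using 2; push_cast; ring
    · rw [show m + 1 - 2 * ((j + 1 : ℕ) : ℤ) - 1 = (m - 2 * ((j + 1 : ℕ) : ℤ) - 1) + 1 by ring,
        neg_one_zpow_add_one]
      have : d (ω j).2 ∈ P (m + 1 - 2 * ((j + 1 : ℕ) : ℤ) + 1) := by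
        refine hQP _ ?_
        convert k3 using 2; push_cast; ring
      simpa [hdd, hed] using Submodule.smul_mem _ ((-1 : ℝ) ^ (m - 2 * (j : ℤ) - 1)) this

/-- `∇ω` lies in filtration degree `i` as soon as it is supported there. -/
lemma nabla_mem_FC (hd : d ∘ₗ d = 0) (hde : d ∘ₗ e = e ∘ₗ d) (hQP : ∀ n, Q n ≤ P n)
    {i m m' : ℤ} (hm : m' = m + 1) {ω : ℕ → A × A} (hω : ω ∈ Csub d e P Q m)
    (hs : nabla d e m ω ∈ (Supp i m' : Submodule ℝ (ℕ → A × A))) :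
    nabla d e m ω ∈ FC d e P Q i m' :=
  mem_FC.2 ⟨nabla_mem_Csub hd hde hQP hm hω, hs, by
    rw [nabla_nabla hd hde hm]; exact zero_mem _⟩

/-- In odd fibre degree, `Z_1^{i,j} ⊆ Z_0^{i+1,j-1}`. -/
lemma Zsp_one_le_of_odd {i j : ℤ} (hj : Odd j) :
    Zsp d e P Q 1 i j ≤ Zsp d e P Q (1 - 1) (i + 1) (j - 1) := by
  intro ω hω
  obtain ⟨h1, h2⟩ := mem_Zsp.1 hω
  obtain ⟨hC, hS, -⟩ := mem_FC.1 h1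
  obtain ⟨-, hS', -⟩ := mem_FC.1 h2
  rw [mem_Zsp, show i + 1 + (j - 1) = i + j by ring, show i + 1 + (1 - 1) = i + 1 by ring]
  refine ⟨mem_FC.2 ⟨hC, ?_, hS'⟩, h2⟩
  rw [mem_Supp] at hS ⊢
  obtain ⟨k, rfl⟩ := hj
  intro l hl
  exact hS l (by omega)

/-- Elements of `Z_1^{i,2k}`: the coefficients above `u^k` vanish, and so does the second
component of the coefficient of `u^k`. -/
lemma mem_Zsp_one_iff (hd : d ∘ₗ d = 0) (hde : d ∘ₗ e = e ∘ₗ d) (hQP : ∀ n, Q n ≤ P n)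
    {i j : ℤ} {k : ℕ} (hj : j = 2 * (k : ℤ)) {ω : ℕ → A × A} :
    ω ∈ Zsp d e P Q 1 i j ↔
      ω ∈ Csub d e P Q (i + j) ∧ (∀ l, k < l → ω l = 0) ∧ (ω k).2 = 0 := by
  subst hj
  constructor
  · intro hω
    obtain ⟨h1, h2⟩ := mem_Zsp.1 hω
    obtain ⟨hC, hS, -⟩ := mem_FC.1 h1
    obtain ⟨-, hS', -⟩ := mem_FC.1 h2
    rw [mem_Supp] at hS hS'
    have hz : ∀ l, k < l → ω l = 0 := fun l hl => hS l (by omega)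
    refine ⟨hC, hz, ?_⟩
    have h := congrArg Prod.fst (hS' (k + 1) (by push_cast; omega))
    rw [nabla_succ_fst, hz (k + 1) (by omega)] at h
    simpa [zpow_ne_zero] using h
  · rintro ⟨hC, hz, hk⟩
    have hS' : ∀ l, k < l → nabla d e (i + 2 * (k : ℤ)) ω l = 0 := by
      intro l hl
      refine Prod.ext ?_ (by simp [nabla_snd, hz l hl])
      obtain ⟨l, rfl⟩ : ∃ l', l = l' + 1 := ⟨l - 1, by omega⟩
      have hl2 : (ω l).2 = 0 := by
        rcases (Nat.lt_succ_iff.1 hl).eq_or_lt with rfl | h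
        · exact hk
        · rw [hz l h]; rfl
      rw [nabla_succ_fst, hz _ hl, hl2]
      simp
    refine mem_Zsp.2 ⟨mem_FC.2 ⟨hC, ?_, ?_⟩, nabla_mem_FC hd hde hQP rfl hC ?_⟩ <;>
      rw [mem_Supp] <;> intro l hl
    · exact hz l (by omega)
    · exact hS' l (by omega)
    · exact hS' l (by omega)

/-- Elements of `Z_0^{i+1,2k-1}`: the coefficients of `u^l`, `l ≥ k`, vanish. -/
lemma mem_Zsp_zero_iff (hd : d ∘ₗ d = 0) (hde : d ∘ₗ e = e ∘ₗ d) (hQP : ∀ n, Q n ≤ P n)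
    {i j : ℤ} {k : ℕ} (hj : j = 2 * (k : ℤ)) {ω : ℕ → A × A} :
    ω ∈ Zsp d e P Q (1 - 1) (i + 1) (j - 1) ↔
      ω ∈ Csub d e P Q (i + j) ∧ ∀ l, k ≤ l → ω l = 0 := by
  subst hj
  rw [mem_Zsp, show i + 1 + (2 * (k : ℤ) - 1) = i + 2 * (k : ℤ) by ring,
    show i + 1 + (1 - 1) = i + 1 by ring]
  constructor
  · rintro ⟨h1, -⟩
    obtain ⟨hC, hS, -⟩ := mem_FC.1 h1
    rw [mem_Supp] at hS
    exact ⟨hC, fun l hl => hS l (by omega)⟩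
  · rintro ⟨hC, hz⟩
    have hS' : nabla d e (i + 2 * (k : ℤ)) ω ∈
        (Supp (i + 1) (i + 2 * (k : ℤ) + 1) : Submodule ℝ (ℕ → A × A)) := by
      rw [mem_Supp]
      intro l hl
      obtain ⟨l, rfl⟩ : ∃ l', l = l' + 1 := ⟨l - 1, by omega⟩
      refine Prod.ext ?_ (by simp [nabla_snd, hz (l + 1) (by omega)])
      rw [nabla_succ_fst, hz (l + 1) (by omega), hz l (by omega)]
      simp
    refine ⟨mem_FC.2 ⟨hC, ?_, hS'⟩, nabla_mem_FC hd hde hQP rfl hC hS'⟩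
    rw [mem_Supp]
    intro l hl
    exact hz l (by omega)

/-- The second components of `K^(i+1)` lie in `G^i`. -/
lemma snd_mem_Gsub {i n : ℤ} (hn : n = i + 1) {x : A × A} (hx : x ∈ Ksub d e P Q n) :
    x.2 ∈ Gsub d e P Q i := by
  subst hn
  obtain ⟨h1, h2, h3, h4⟩ := mem_Ksub.1 hx
  rw [add_sub_cancel_right] at h2 h4
  exact mem_Gsub.2 ⟨h2, h3, x.1, h1, by rwa [add_assoc] at h4⟩

lemma single_mem_Csub {m n : ℤ} {k : ℕ} (hn : m - 2 * (k : ℤ) = n) {x : A × A}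
    (hx : x ∈ Ksub d e P Q n) : (Pi.single k x : ℕ → A × A) ∈ Csub d e P Q m := by
  subst hn
  rw [mem_Csub]
  intro l
  rcases eq_or_ne l k with rfl | h
  · simpa using hx
  · simp [h]

lemma fst_mem_Om {n : ℤ} {x : A × A} (hx : x ∈ Ksub d e P Q n) (h2 : x.2 = 0) :
    x.1 ∈ Om d P n := by
  obtain ⟨h1, -, -, h4⟩ := mem_Ksub.1 hx
  exact mem_Om.2 ⟨h1, by simpa [h2] using h4⟩

lemma inl_mem_Ksub {n : ℤ} {α : A} (hα : α ∈ Om d P n) : (α, (0 : A)) ∈ Ksub d e P Q n :=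
  mem_Ksub.2 ⟨hα.1, by simp, by simp, by simpa using (mem_Om.1 hα).2⟩

lemma coeff_fst_mem_Om (hd : d ∘ₗ d = 0) (hde : d ∘ₗ e = e ∘ₗ d) (hQP : ∀ n, Q n ≤ P n)
    {i j : ℤ} {k : ℕ} (hj : j = 2 * (k : ℤ)) {ω : ℕ → A × A} (hω : ω ∈ Zsp d e P Q 1 i j) :
    (ω k).1 ∈ Om d P i := by
  obtain ⟨hC, -, hk⟩ := (mem_Zsp_one_iff hd hde hQP hj).1 hω
  have := mem_Csub.1 hC k
  rw [hj, add_sub_cancel_right] at this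
  exact fst_mem_Om this hk

/-- The coefficient of `u^k`, as a map `Z_1^{i,2k} → Ω^i`. -/
def coeffOm (hd : d ∘ₗ d = 0) (hde : d ∘ₗ e = e ∘ₗ d) (hQP : ∀ n, Q n ≤ P n)
    {i j : ℤ} {k : ℕ} (hj : j = 2 * (k : ℤ)) : Zsp d e P Q 1 i j →ₗ[ℝ] Om d P i :=
  (LinearMap.fst ℝ A A ∘ₗ
      LinearMap.proj (R := ℝ) (φ := fun _ : ℕ => A × A) k).restrict fun _ hω => coeff_fst_mem_Om hd hde hQP hj hω

lemma coeffOm_surjective (hd : d ∘ₗ d = 0) (hde : d ∘ₗ e = e ∘ₗ d) (hQP : ∀ n, Q n ≤ P n)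
    {i j : ℤ} {k : ℕ} (hj : j = 2 * (k : ℤ)) :
    Function.Surjective (coeffOm (i := i) hd hde hQP hj) := by
  rintro ⟨α, hα⟩
  refine ⟨⟨Pi.single k (α, 0), (mem_Zsp_one_iff hd hde hQP hj).2
    ⟨single_mem_Csub (n := i) (by omega) (inl_mem_Ksub hα), ?_, by simp⟩⟩, ?_⟩
  · intro l hl
    simp [hl.ne']
  · refine Subtype.ext ?_
    change ((Pi.single k (α, 0) : ℕ → A × A) k).1 = α
    rw [Pi.single_eq_same]

lemma mem_Zsp_zero_of_coeff_eq_zero (hd : d ∘ₗ d = 0) (hde : d ∘ₗ e = e ∘ₗ d)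
    (hQP : ∀ n, Q n ≤ P n) {i j : ℤ} {k : ℕ} (hj : j = 2 * (k : ℤ)) {ω : ℕ → A × A}
    (hω : ω ∈ Zsp d e P Q 1 i j) (h : (ω k).1 = 0) :
    ω ∈ Zsp d e P Q (1 - 1) (i + 1) (j - 1) := by
  obtain ⟨hC, hz, hk⟩ := (mem_Zsp_one_iff hd hde hQP hj).1 hω
  refine (mem_Zsp_zero_iff hd hde hQP hj).2 ⟨hC, fun l hl => ?_⟩
  rcases hl.eq_or_lt with rfl | hl
  · exact Prod.ext h hk
  · exact hz l hl

/-- Elements of `F^i C^(i+2k-1)` have no coefficient of `u^l` for `l ≥ k`. -/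
lemma coeff_eq_zero_of_mem_FC {i m : ℤ} {k : ℕ} (hm : m = i + 2 * (k : ℤ) - 1)
    {η : ℕ → A × A} (hη : η ∈ FC d e P Q i m) {l : ℕ} (hl : k ≤ l) : η l = 0 :=
  mem_Supp.1 (mem_FC.1 hη).2.1 l (by omega)

/-- For `k = 0` the denominator of `E_1` consists of the elements with zero leading term. -/
lemma ker_coeffOm_zero (hd : d ∘ₗ d = 0) (hde : d ∘ₗ e = e ∘ₗ d) (hQP : ∀ n, Q n ≤ P n)
    {i j : ℤ} (hj : j = 2 * ((0 : ℕ) : ℤ)) :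
    (Zsp d e P Q (1 - 1) (i + 1) (j - 1) ⊔ Bsp d e P Q (1 - 1) i j).comap
      (Zsp d e P Q 1 i j).subtype = LinearMap.ker (coeffOm (i := i) hd hde hQP hj) := by
  ext ⟨ω, hω⟩
  rw [Submodule.mem_comap, LinearMap.mem_ker, Submodule.subtype_apply, Submodule.mem_sup]
  constructor
  · rintro ⟨z, hzZ, b, ⟨-, η, hη, hb⟩, hzb⟩
    have hη' : η ∈ FC d e P Q i (i + j - 1) := by simpa using hη
    have hη0 : η = 0 := funext fun l =>
      coeff_eq_zero_of_mem_FC (k := 0) (by omega) hη' (Nat.zero_le l)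
    have hz0 := ((mem_Zsp_zero_iff hd hde hQP hj).1 hzZ).2 0 le_rfl
    rw [hη0, map_zero] at hb
    subst hb
    obtain rfl : z = ω := by simpa using hzb
    exact Subtype.ext (congrArg Prod.fst hz0)
  · intro h
    refine ⟨ω, mem_Zsp_zero_of_coeff_eq_zero hd hde hQP hj hω ?_, 0, zero_mem _, add_zero _⟩
    exact congrArg Subtype.val h

/-- For `k > 0` the denominator of `E_1` consists of the elements whose leading term lies
in `G`. -/
lemma ker_coeffOm_succ (hd : d ∘ₗ d = 0) (hde : d ∘ₗ e = e ∘ₗ d) (hQP : ∀ n, Q n ≤ P n)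
    {i j : ℤ} {k : ℕ} (hj : j = 2 * ((k + 1 : ℕ) : ℤ)) :
    (Zsp d e P Q (1 - 1) (i + 1) (j - 1) ⊔ Bsp d e P Q (1 - 1) i j).comap
      (Zsp d e P Q 1 i j).subtype =
    LinearMap.ker (((Gsub d e P Q i).comap (Om d P i).subtype).mkQ ∘ₗ
      coeffOm (i := i) hd hde hQP hj) := by
  ext ⟨ω, hω⟩
  rw [Submodule.mem_comap, LinearMap.mem_ker, Submodule.subtype_apply, Submodule.mem_sup,
    LinearMap.comp_apply, Submodule.mkQ_apply, Submodule.Quotient.mk_eq_zero,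
    Submodule.mem_comap]
  change _ ↔ (ω (k + 1)).1 ∈ Gsub d e P Q i
  constructor
  · rintro ⟨z, hzZ, b, ⟨-, η, hη, rfl⟩, rfl⟩
    have hη' : η ∈ FC d e P Q i (i + j - 1) := by simpa using hη
    have hη0 := coeff_eq_zero_of_mem_FC (k := k + 1) (by omega) hη' le_rfl
    have hz0 := ((mem_Zsp_zero_iff hd hde hQP hj).1 hzZ).2 (k + 1) le_rfl
    rw [Pi.add_apply, Prod.fst_add, nabla_succ_fst, hη0, hz0]
    simp only [Prod.fst_zero, Prod.snd_zero, map_zero, smul_zero, zero_add]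
    exact Submodule.smul_mem _ _
      (snd_mem_Gsub (by push_cast at hj; omega) (mem_Csub.1 (mem_FC.1 hη').1 k))
  · intro h
    obtain ⟨h1, h2, α, h3, h4⟩ := mem_Gsub.1 h
    set β := (ω (k + 1)).1 with hβ
    have hK : (α, β) ∈ Ksub d e P Q (i + 1) := by
      refine mem_Ksub.2 ⟨h3, ?_, h2, ?_⟩
      · rwa [add_sub_cancel_right]
      · rwa [add_sub_cancel_right, add_assoc]
    set s : ℝ := (-1 : ℝ) ^ i with hs
    have hss : s * s = 1 := by
      rw [hs, ← mul_zpow]; simp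
    set η : ℕ → A × A := Pi.single k (s • (α, β)) with hη
    have hηC : η ∈ Csub d e P Q (i + j - 1) :=
      single_mem_Csub (n := i + 1) (by push_cast at hj; omega) (Submodule.smul_mem _ _ hK)
    have hηz : ∀ l, k < l → η l = 0 := fun l hl => by simp [hη, hl.ne']
    have hbz : ∀ l, k + 1 < l → nabla d e (i + j - 1) η l = 0 := by
      intro l hl
      obtain ⟨l, rfl⟩ : ∃ l', l = l' + 1 := ⟨l - 1, by omega⟩
      refine Prod.ext ?_ (by simp [nabla_snd, hηz (l + 1) (by omega)])
      rw [nabla_succ_fst, hηz (l + 1) (by omega), hηz l (by omega)]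
      simp
    have hbS : nabla d e (i + j - 1) η ∈ (Supp i (i + j) : Submodule ℝ (ℕ → A × A)) :=
      mem_Supp.2 fun l hl => hbz l (by omega)
    have hbF : nabla d e (i + j - 1) η ∈ FC d e P Q i (i + j) :=
      nabla_mem_FC hd hde hQP (by ring) hηC hbS
    have hηF : η ∈ FC d e P Q i (i + j - 1) :=
      mem_FC.2 ⟨hηC, mem_Supp.2 fun l hl => hηz l (by push_cast at hj; omega),
        by rwa [sub_add_cancel]⟩
    have hlead : nabla d e (i + j - 1) η (k + 1) = (β, 0) := by
      refine Prod.ext ?_ (by simp [nabla_snd, hηz (k + 1) (by omega)])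
      rw [nabla_succ_fst, hηz (k + 1) (by omega),
        show i + j - 1 - 2 * (k : ℤ) - 1 = i by push_cast at hj; omega, ← hs]
      simp [hη, smul_smul, hss]
    have hbZ : nabla d e (i + j - 1) η ∈ Zsp d e P Q 1 i j :=
      (mem_Zsp_one_iff hd hde hQP hj).2 ⟨(mem_FC.1 hbF).1, hbz, by rw [hlead]⟩
    refine ⟨ω - nabla d e (i + j - 1) η,
      mem_Zsp_zero_of_coeff_eq_zero hd hde hQP hj (sub_mem hω hbZ) ?_, _,
      ⟨hbF, η, by simpa using hηF, rfl⟩, sub_add_cancel _ _⟩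
    rw [Pi.sub_apply, Prod.fst_sub, hlead, sub_self]

/-- `E_1^{i,0} ≅ Ω^i`. -/
def espEquivOm (hd : d ∘ₗ d = 0) (hde : d ∘ₗ e = e ∘ₗ d) (hQP : ∀ n, Q n ≤ P n)
    {i j : ℤ} (hj : j = 2 * ((0 : ℕ) : ℤ)) : Esp d e P Q 1 i j ≃ₗ[ℝ] Om d P i :=
  Submodule.quotEquivOfEq _ _ (ker_coeffOm_zero hd hde hQP hj) ≪≫ₗ
    (coeffOm hd hde hQP hj).quotKerEquivOfSurjective (coeffOm_surjective hd hde hQP hj)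

/-- `E_1^{i,2(k+1)} ≅ Ω^i / G^i`. -/
def espEquivKq (hd : d ∘ₗ d = 0) (hde : d ∘ₗ e = e ∘ₗ d) (hQP : ∀ n, Q n ≤ P n)
    {i j : ℤ} {k : ℕ} (hj : j = 2 * ((k + 1 : ℕ) : ℤ)) :
    Esp d e P Q 1 i j ≃ₗ[ℝ] Kq d e P Q i :=
  Submodule.quotEquivOfEq _ _ (ker_coeffOm_succ hd hde hQP hj) ≪≫ₗ
    (((Gsub d e P Q i).comap (Om d P i).subtype).mkQ ∘ₗ
      coeffOm (i := i) hd hde hQP hj).quotKerEquivOfSurjective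
        ((Submodule.mkQ_surjective _).comp (coeffOm_surjective hd hde hQP hj))

/-- `∇` maps `Z_1^{i,2k}` into `Z_1^{i+1,2k}`. -/
lemma nabla_mem_Zsp_one (hd : d ∘ₗ d = 0) (hde : d ∘ₗ e = e ∘ₗ d) (hQP : ∀ n, Q n ≤ P n)
    {i j j' : ℤ} {k : ℕ} (hj : j = 2 * (k : ℤ)) (hj' : j' = j) {ω : ℕ → A × A}
    (hω : ω ∈ Zsp d e P Q 1 i j) : nabla d e (i + j) ω ∈ Zsp d e P Q 1 (i + 1) j' := by
  subst hj'
  obtain ⟨hC, -, hk⟩ := (mem_Zsp_one_iff hd hde hQP hj).1 hω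
  refine (mem_Zsp_one_iff hd hde hQP hj).2
    ⟨nabla_mem_Csub hd hde hQP (by ring) hC, fun l hl => ?_, by simp [nabla_snd, hk]⟩
  exact mem_Supp.1 (mem_FC.1 (mem_Zsp.1 hω).2).2.1 l (by omega)

end FirstPage

/-- the first page of the spectral sequence of the filtered complex `(C, F)`:
`E_1^{i,j} = 0` for odd `j`; `E_1^{i,0} ≅ Ω^i` (via the coefficient of `u^0`), with
`d_1 : E_1^{i,0} → E_1^{i+1,0}` given by `α ↦ dα`; and for `j > 0`,
`E_1^{i,2j} ≅ (Ω^i/G^i) ⊗ ℝ·u^j` (via the coefficient of `u^j`), with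
`d_1 : E_1^{i,2j} → E_1^{i+1,2j}` induced by `d`, i.e. the differential of the
co-Gysin complex `𝒦 = Ω/G`. -/
theorem statement_6 {A : Type*} [AddCommGroup A] [Module ℝ A]
    (d e : A →ₗ[ℝ] A) (hd : d ∘ₗ d = 0) (hde : d ∘ₗ e = e ∘ₗ d)
    (P Q : ℤ → Submodule ℝ A) (hQP : ∀ n, Q n ≤ P n)
    (hPneg : ∀ n : ℤ, n < 0 → P n = ⊥) (hQneg : ∀ n : ℤ, n < 0 → Q n = ⊥)
    (i : ℤ) :
    -- E_1^{i,j} = 0 for odd j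
    (∀ j : ℤ, Odd j → ∀ x : Esp d e P Q 1 i j, x = 0) ∧
    -- E_1^{i,0} ≅ Ω^i  and  d_1 = d  under this identification
    (∃ φ : Esp d e P Q 1 i 0 ≃ₗ[ℝ] Om d P i,
      (∀ (ω : ℕ → A × A) (hω : ω ∈ Zsp d e P Q 1 i 0) (h1 : (ω 0).1 ∈ Om d P i),
        φ (Submodule.Quotient.mk ⟨ω, hω⟩) = ⟨(ω 0).1, h1⟩) ∧
      ∀ φ' : Esp d e P Q 1 (i + 1) (0 - 1 + 1) ≃ₗ[ℝ] Om d P (i + 1),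
        (∀ (ω : ℕ → A × A) (hω : ω ∈ Zsp d e P Q 1 (i + 1) (0 - 1 + 1))
          (h1 : (ω 0).1 ∈ Om d P (i + 1)),
          φ' (Submodule.Quotient.mk ⟨ω, hω⟩) = ⟨(ω 0).1, h1⟩) →
        ∀ d1 : Esp d e P Q 1 i 0 →ₗ[ℝ] Esp d e P Q 1 (i + 1) (0 - 1 + 1),
          DrChar d e P Q 1 i 0 (i + 1) (0 - 1 + 1) d1 →
            ∀ x : Esp d e P Q 1 i 0, (φ' (d1 x) : A) = d (φ x : A)) ∧
    -- E_1^{i,2j} ≅ (Ω^i/G^i) ⊗ ℝ·u^j for j > 0, and d_1 is induced by d on 𝒦 = Ω/G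
    (∀ j : ℕ, 0 < j →
      ∃ ψ : Esp d e P Q 1 i (2 * (j : ℤ)) ≃ₗ[ℝ] Kq d e P Q i,
        (∀ (ω : ℕ → A × A) (hω : ω ∈ Zsp d e P Q 1 i (2 * (j : ℤ)))
          (h1 : (ω j).1 ∈ Om d P i),
          ψ (Submodule.Quotient.mk ⟨ω, hω⟩) = Submodule.Quotient.mk ⟨(ω j).1, h1⟩) ∧
        ∀ ψ' : Esp d e P Q 1 (i + 1) (2 * (j : ℤ) - 1 + 1) ≃ₗ[ℝ] Kq d e P Q (i + 1),
          (∀ (ω : ℕ → A × A) (hω : ω ∈ Zsp d e P Q 1 (i + 1) (2 * (j : ℤ) - 1 + 1))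
            (h1 : (ω j).1 ∈ Om d P (i + 1)),
            ψ' (Submodule.Quotient.mk ⟨ω, hω⟩) = Submodule.Quotient.mk ⟨(ω j).1, h1⟩) →
          ∀ Kd : Kq d e P Q i →ₗ[ℝ] Kq d e P Q (i + 1),
            (∀ (α : A) (hα : α ∈ Om d P i) (hα' : d α ∈ Om d P (i + 1)),
              Kd (Submodule.Quotient.mk ⟨α, hα⟩) = Submodule.Quotient.mk ⟨d α, hα'⟩) →
            ∀ d1 : Esp d e P Q 1 i (2 * (j : ℤ)) →ₗ[ℝ]
                Esp d e P Q 1 (i + 1) (2 * (j : ℤ) - 1 + 1),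
              DrChar d e P Q 1 i (2 * (j : ℤ)) (i + 1) (2 * (j : ℤ) - 1 + 1) d1 →
                ∀ x, ψ' (d1 x) = Kd (ψ x)) := by
  have hdd : ∀ x, d (d x) = 0 := fun x => LinearMap.congr_fun hd x
  refine ⟨?_, ⟨espEquivOm hd hde hQP (by simp), fun ω hω h1 => rfl, ?_⟩, ?_⟩
  · intro j hj x
    obtain ⟨⟨ω, hω⟩, rfl⟩ := Submodule.Quotient.mk_surjective _ x
    rw [Submodule.Quotient.mk_eq_zero]
    exact Submodule.mem_sup_left (Zsp_one_le_of_odd hj hω)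
  · intro φ' hφ' d1 hd1 x
    obtain ⟨⟨ω, hω⟩, rfl⟩ := Submodule.Quotient.mk_surjective _ x
    have hω' := nabla_mem_Zsp_one (k := 0) (j' := 0 - 1 + 1) hd hde hQP (by simp) (by ring) hω
    have h1 := coeff_fst_mem_Om (k := 0) hd hde hQP (by simp) hω'
    rw [hd1 ω hω hω', hφ' _ hω' h1]
    change (nabla d e (i + 0) ω 0).1 = d (ω 0).1
    rw [nabla_zero_fst, ((mem_Zsp_one_iff (k := 0) hd hde hQP (by simp)).1 hω).2.2]
    simp
  · intro j hj
    obtain ⟨k, rfl⟩ : ∃ k, j = k + 1 := ⟨j - 1, by omega⟩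
    refine ⟨espEquivKq hd hde hQP rfl, fun ω hω h1 => rfl, ?_⟩
    intro ψ' hψ' Kd hKd d1 hd1 x
    obtain ⟨⟨ω, hω⟩, rfl⟩ := Submodule.Quotient.mk_surjective _ x
    have hω' := nabla_mem_Zsp_one (j' := 2 * ((k + 1 : ℕ) : ℤ) - 1 + 1) hd hde hQP rfl
      (by ring) hω
    have h1 := coeff_fst_mem_Om (k := k + 1) hd hde hQP (by ring) hω'
    have h0 := coeff_fst_mem_Om (k := k + 1) hd hde hQP rfl hω
    have h0' : d (ω (k + 1)).1 ∈ Om d P (i + 1) := mem_Om.2 ⟨h0.2, by simp [hdd]⟩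
    rw [hd1 ω hω hω', hψ' _ hω' h1]
    change _ = Kd (Submodule.Quotient.mk ⟨(ω (k + 1)).1, h0⟩)
    rw [hKd _ h0 h0', Submodule.Quotient.eq, Submodule.mem_comap]
    change (nabla d e (i + 2 * ((k + 1 : ℕ) : ℤ)) ω (k + 1)).1 - d (ω (k + 1)).1 ∈ _
    obtain ⟨hC, -, hk⟩ := (mem_Zsp_one_iff (k := k + 1) hd hde hQP rfl).1 hω
    rw [nabla_succ_fst, hk, map_zero, smul_zero, add_zero, add_sub_cancel_left]
    exact Submodule.smul_mem _ _
      (snd_mem_Gsub (by push_cast; ring) (mem_Csub.1 hC k))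

end IG

end
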